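/- arXiv:cs/0402040 — 2 statements merged into one kernel-verified Lean document; each statement's English description precedes it below -/
import Mathlib

section
/- If x is a signal and 0 ≤ m ≤ d, then the functions t ↦ ⋂_{ξ∈[t−d,t−d+m]} x(ξ) (which equals 1 at t iff x(ξ) = 1 for all ξ ∈ [t−d,t−d+m]) and t ↦ ⋃_{ξ∈[t−d,t−d+m]} x(ξ) (which equals 1 at t iff x(ξ) = 1 for some ξ ∈ [t−d,t−d+m]) are signals. -/
/-- `x : ℝ → Bool` is a signal: there is an unbounded strictly increasing
sequence `0 ≤ t 0 < t 1 < ...` such that `x` is constant, equal to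
`x (t 0 - 1)`, on `(-∞, t 0)` and constant, equal to `x (t k)`, on each
`[t k, t (k+1))`. -/
def IsSignal (x : ℝ → Bool) : Prop :=
  ∃ t : ℕ → ℝ, 0 ≤ t 0 ∧ StrictMono t ∧ (∀ M : ℝ, ∃ n : ℕ, M < t n) ∧
    (∀ s : ℝ, s < t 0 → x s = x (t 0 - 1)) ∧
    (∀ k : ℕ, ∀ s : ℝ, t k ≤ s → s < t (k + 1) → x s = x (t k))

/-- The set `S` of signals, as a subtype. -/
abbrev Signal := {x : ℝ → Bool // IsSignal x}

/-- The pointwise negation of a signal is a signal. -/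
theorem IsSignal.not {x : ℝ → Bool} (h : IsSignal x) : IsSignal (fun t => !x t) := by
  obtain ⟨t, h0, hm, hu, h1, h2⟩ := h
  exact ⟨t, h0, hm, hu, fun s hs => by simp only [h1 s hs],
    fun k s hk1 hk2 => by simp only [h2 k s hk1 hk2]⟩

/-- Pointwise negation on signals. -/
def Signal.neg (x : Signal) : Signal := ⟨fun t => !x.1 t, x.2.not⟩

/-- The stability condition for a couple `(u, x)`. -/
def SC (u x : Signal) : Prop :=
  ∀ a : Bool, (∃ t₁ : ℝ, ∀ t : ℝ, t₁ ≤ t → u.1 t = a) →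
    (∃ t₂ : ℝ, ∀ t : ℝ, t₂ ≤ t → x.1 t = a)

/-- The set of solutions of the stability condition. -/
def SolSC (u : Signal) : Set Signal := {x | SC u x}

/-- A delay condition: `i u` is nonempty and included in `SolSC u` for all `u`. -/
def IsDC (i : Signal → Set Signal) : Prop :=
  ∀ u : Signal, (i u).Nonempty ∧ i u ⊆ SolSC u

/-- A deterministic delay condition. -/
def Deterministic (i : Signal → Set Signal) : Prop :=
  ∀ u : Signal, ∃ x : Signal, i u = {x}

/-- The translation `x ∘ τ^d`, i.e. `t ↦ x (t - d)`. -/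
def Translate (d : ℝ) (x : ℝ → Bool) : ℝ → Bool := fun t => x (t - d)

/-- Time invariance of a delay condition. -/
def TimeInvariant (i : Signal → Set Signal) : Prop :=
  ∀ (u x : Signal) (d : ℝ) (hu : IsSignal (Translate d u.1)),
    x ∈ i u → ∃ hx : IsSignal (Translate d x.1),
      (⟨Translate d x.1, hx⟩ : Signal) ∈ i ⟨Translate d u.1, hu⟩

/-- `LeftLim x t b` : the left limit `x (t - 0)` exists and equals `b`. -/
def LeftLim (x : ℝ → Bool) (t : ℝ) (b : Bool) : Prop :=
  ∃ ε : ℝ, 0 < ε ∧ ∀ ξ : ℝ, t - ε < ξ → ξ < t → x ξ = b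

/-- A constant delay condition. -/
def ConstantDC (i : Signal → Set Signal) : Prop :=
  ∃ dr : ℝ, 0 ≤ dr ∧ ∃ df : ℝ, 0 ≤ df ∧ ∀ u : Signal, ∀ x ∈ i u, ∀ t : ℝ, ∀ b : Bool,
    LeftLim x.1 t b → ((!b && x.1 t) ≤ u.1 (t - dr)) ∧ ((b && !(x.1 t)) ≤ !(u.1 (t - df)))

/-- A rising-falling symmetrical delay condition. -/
def Symmetrical (i : Signal → Set Signal) : Prop :=
  ∀ u : Signal, i (Signal.neg u) = Signal.neg '' (i u)

/-- The serial connection `i ∘ j`. -/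
def serial (i j : Signal → Set Signal) : Signal → Set Signal :=
  fun u => {y | ∃ x ∈ j u, y ∈ i x}

open Classical in
/-- `⋂_{ξ ∈ [a,b]} x(ξ)` : `true` iff `x ξ = true` for all `ξ ∈ [a,b]`. -/
noncomputable def infOn (x : ℝ → Bool) (a b : ℝ) : Bool :=
  if ∀ ξ ∈ Set.Icc a b, x ξ = true then true else false

open Classical in
/-- `⋃_{ξ ∈ [a,b]} x(ξ)` : `true` iff `x ξ = true` for some `ξ ∈ [a,b]`. -/
noncomputable def supOn (x : ℝ → Bool) (a b : ℝ) : Bool :=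
  if ∃ ξ ∈ Set.Icc a b, x ξ = true then true else false

/-- A set of reals that is unbounded above and has finite initial segments is the range of a
strictly increasing unbounded sequence without gaps. -/
theorem exists_strictMono_enumeration {S : Set ℝ} (hfin : ∀ M : ℝ, (S ∩ Set.Iic M).Finite)
    (hub : ∀ M : ℝ, ∃ p ∈ S, M < p) :
    ∃ t : ℕ → ℝ, StrictMono t ∧ (∀ n, t n ∈ S) ∧ (∀ M : ℝ, ∃ n, M < t n) ∧
      (∀ p ∈ S, t 0 ≤ p) ∧ ∀ k, ∀ p ∈ S, t k < p → t (k + 1) ≤ p := by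
  have exists_least : ∀ A : Set ℝ, A ⊆ S → A.Nonempty → ∃ q ∈ A, ∀ p ∈ A, q ≤ p := by
    rintro A hA ⟨r, hr⟩
    obtain ⟨q, ⟨hq, hqr⟩, hmin⟩ := Set.exists_min_image (A ∩ Set.Iic r) id
      ((hfin r).subset (Set.inter_subset_inter_left _ hA)) ⟨r, hr, le_refl r⟩
    refine ⟨q, hq, fun p hp => ?_⟩
    rcases le_total p r with h | h
    · exact hmin p ⟨hp, h⟩
    · exact le_trans hqr h
  have exists_next : ∀ s : ℝ, ∃ q, (q ∈ S ∧ s < q) ∧ ∀ p ∈ S, s < p → q ≤ p := by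
    intro s
    obtain ⟨q, hq, hmin⟩ := exists_least {p | p ∈ S ∧ s < p} (fun p hp => hp.1) (hub s)
    exact ⟨q, hq, fun p hp hsp => hmin p ⟨hp, hsp⟩⟩
  choose next hnext hleast using exists_next
  obtain ⟨r, hr, -⟩ := hub 0
  obtain ⟨q, hq, hmin⟩ := exists_least S subset_rfl ⟨r, hr⟩
  let t : ℕ → ℝ := fun n => next^[n] q
  have ht : ∀ n, t (n + 1) = next (t n) := fun n => Function.iterate_succ_apply' next n q
  have hmono : StrictMono t := strictMono_nat_of_lt_succ fun n => by
    rw [ht]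
    exact (hnext _).2
  have hmem : ∀ n, t n ∈ S := by
    rintro (_ | n)
    · exact hq
    · rw [ht]
      exact (hnext _).1
  refine ⟨t, hmono, hmem, fun M => ?_, hmin, fun k p hp hkp => ?_⟩
  · by_contra! h
    exact Set.infinite_range_of_injective hmono.injective
      ((hfin M).subset (Set.range_subset_iff.2 fun n => ⟨hmem n, h n⟩))
  · rw [ht]
    exact hleast _ p hp hkp

/-- A function that can only change its value at the points of a set `S` of nonnegative reals,
unbounded above and with finite initial segments, is a signal. -/
theorem IsSignal.of_switching_set {y : ℝ → Bool} {S : Set ℝ} (hnonneg : ∀ p ∈ S, 0 ≤ p)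
    (hfin : ∀ M : ℝ, (S ∩ Set.Iic M).Finite) (hub : ∀ M : ℝ, ∃ p ∈ S, M < p)
    (hy : ∀ a b : ℝ, a ≤ b → (∀ p ∈ S, a < p → b < p) → y a = y b) : IsSignal y := by
  obtain ⟨t, hmono, hmem, hunb, hmin, hgap⟩ := exists_strictMono_enumeration hfin hub
  refine ⟨t, hnonneg _ (hmem 0), hmono, hunb, fun s hs => ?_, fun k s hk hs => ?_⟩
  · rcases le_total s (t 0 - 1) with h | h
    · exact hy _ _ h fun p hp _ => by linarith [hmin p hp]
    · exact (hy _ _ h fun p hp _ => by linarith [hmin p hp]).symm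
  · exact (hy _ _ hk fun p hp hkp => hs.trans_le (hgap k p hp hkp)).symm

/-- A piecewise constant function keeps its value along an interval `(a, b]` without switching
points. -/
theorem eq_of_no_switch {x : ℝ → Bool} {t : ℕ → ℝ} (hunb : ∀ M : ℝ, ∃ n, M < t n)
    (hinit : ∀ s, s < t 0 → x s = x (t 0 - 1))
    (hstep : ∀ k, ∀ s, t k ≤ s → s < t (k + 1) → x s = x (t k))
    {a b : ℝ} (hab : a ≤ b) (h : ∀ k, a < t k → b < t k) : x a = x b := by
  classical
  have hlt := Nat.find_spec (hunb a)
  have hmin := fun k => Nat.find_min (hunb a) (m := k)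
  generalize Nat.find (hunb a) = n at hlt hmin
  rcases n with _ | n
  · rw [hinit a hlt, hinit b (h 0 hlt)]
  · have hn : t n ≤ a := not_lt.1 (hmin n n.lt_succ_self)
    rw [hstep n a hn hlt, hstep n b (hn.trans hab) (h _ hlt)]

theorem StrictMono.finite_range_inter_Iic {t : ℕ → ℝ} (hmono : StrictMono t)
    (hunb : ∀ M : ℝ, ∃ n, M < t n) (M : ℝ) : (Set.range t ∩ Set.Iic M).Finite := by
  obtain ⟨n, hn⟩ := hunb M
  refine ((Set.finite_Iio n).image t).subset ?_
  rintro _ ⟨⟨k, rfl⟩, hk⟩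
  exact ⟨k, hmono.lt_iff_lt.1 (lt_of_le_of_lt hk hn), rfl⟩

theorem IsSignal.supOn {x : ℝ → Bool} (hx : IsSignal x) {m d : ℝ} (hm : 0 ≤ m) (hmd : m ≤ d) :
    IsSignal (fun t => supOn x (t - d) (t - d + m)) := by
  obtain ⟨t, h0, hmono, hunb, hinit, hstep⟩ := hx
  have hpos : ∀ k, 0 ≤ t k := fun k => h0.trans (hmono.monotone k.zero_le)
  have hshift : ∀ c : ℝ, StrictMono fun k => t k + c := fun c _ _ h => by
    simpa using hmono h
  have hshift_unb : ∀ c M : ℝ, ∃ n, M < t n + c := fun c M => by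
    obtain ⟨n, hn⟩ := hunb (M - c)
    exact ⟨n, by linarith⟩
  refine IsSignal.of_switching_set
    (S := (Set.range fun k => t k + d) ∪ Set.range fun k => t k + (d - m)) ?_ ?_ ?_ ?_
  · rintro _ (⟨k, rfl⟩ | ⟨k, rfl⟩)
    · have := hpos k
      dsimp only
      linarith
    · have := hpos k
      dsimp only
      linarith
  · intro M
    rw [Set.union_inter_distrib_right]
    exact ((hshift d).finite_range_inter_Iic (hshift_unb d) M).union
      ((hshift (d - m)).finite_range_inter_Iic (hshift_unb (d - m)) M)
  · intro M
    obtain ⟨n, hn⟩ := hshift_unb d M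
    exact ⟨_, Or.inl ⟨n, rfl⟩, hn⟩
  · intro a b hab hS
    have hleft : ∀ k, a - d < t k → b - d < t k := fun k hk => by
      linarith [hS _ (Or.inl ⟨k, rfl⟩) (by linarith)]
    have hright : ∀ k, a - d + m < t k → b - d + m < t k := fun k hk => by
      linarith [hS _ (Or.inr ⟨k, rfl⟩) (by linarith)]
    have hiff : (∃ ξ ∈ Set.Icc (a - d) (a - d + m), x ξ = true) ↔
        ∃ ξ ∈ Set.Icc (b - d) (b - d + m), x ξ = true := by
      constructor
      · rintro ⟨ξ, ⟨h1, h2⟩, hξ⟩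
        rcases le_total (b - d) ξ with h | h
        · exact ⟨ξ, ⟨h, by linarith⟩, hξ⟩
        · refine ⟨b - d, ⟨le_rfl, by linarith⟩, ?_⟩
          rw [← hξ]
          exact (eq_of_no_switch hunb hinit hstep h
            fun k hk => hleft k (h1.trans_lt hk)).symm
      · rintro ⟨ξ, ⟨h1, h2⟩, hξ⟩
        rcases le_total ξ (a - d + m) with h | h
        · exact ⟨ξ, ⟨by linarith, h⟩, hξ⟩
        · refine ⟨a - d + m, ⟨by linarith, le_rfl⟩, ?_⟩
          rw [← hξ]
          exact eq_of_no_switch hunb hinit hstep h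
            fun k hk => h2.trans_lt (hright k hk)
    rw [Bool.eq_iff_iff]
    simpa only [_root_.supOn, Bool.if_true_left, Bool.or_false, decide_eq_true_eq] using hiff

theorem infOn_eq_not_supOn_not (x : ℝ → Bool) (a b : ℝ) :
    infOn x a b = !supOn (fun ξ => !x ξ) a b := by
  rw [Bool.eq_iff_iff]
  simp [infOn, supOn]

theorem infOn_supOn_are_signals (x : ℝ → Bool) (hx : IsSignal x)
    (m d : ℝ) (hm : 0 ≤ m) (hmd : m ≤ d) :
    IsSignal (fun t => infOn x (t - d) (t - d + m)) ∧
    IsSignal (fun t => supOn x (t - d) (t - d + m)) := by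
  simp only [infOn_eq_not_supOn_not]
  exact ⟨(hx.not.supOn hm hmd).not, hx.supOn hm hmd⟩
end

section
/- Let 0 ≤ m ≤ d. The functions i(u) = { t ↦ ⋂_{ξ∈[t−d,t−d+m]} u(ξ) } and j(u) = { t ↦ ⋃_{ξ∈[t−d,t−d+m]} u(ξ) } are deterministic, time invariant, constant DCs. -/
/-- A strictly ordered enumeration of an unbounded set of reals with finite initial segments. -/
theorem exists_strictMono_enumeration_s13 {P : Set ℝ} (hfin : ∀ M, (P ∩ Set.Iic M).Finite)
    (hunb : ∀ M, ∃ p ∈ P, M < p) :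
    ∃ t : ℕ → ℝ, StrictMono t ∧ Set.range t = P := by
  classical
  obtain ⟨p₀, hp₀, -⟩ := hunb 0
  obtain ⟨q, hq, hmin⟩ := Set.exists_min_image (P ∩ Set.Iic p₀) id (hfin p₀) ⟨p₀, hp₀, le_refl p₀⟩
  let _ : OrderBot P :=
    { bot := ⟨q, hq.1⟩
      bot_le := fun p => by
        rcases le_total p.1 p₀ with h | h
        · exact hmin p.1 ⟨p.2, h⟩
        · exact le_trans (b := p₀) hq.2 h }
  let _ : LocallyFiniteOrder P := LocallyFiniteOrder.ofFiniteIcc fun a b => by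
    refine Set.Finite.of_finite_image ((hfin b.1).subset ?_) Subtype.val_injective.injOn
    rintro _ ⟨p, hp, rfl⟩
    exact ⟨p.2, hp.2⟩
  have : NoMaxOrder P := ⟨fun a => by
    obtain ⟨p, hp, h⟩ := hunb a.1
    exact ⟨⟨p, hp⟩, h⟩⟩
  let _ : SuccOrder P := LinearLocallyFiniteOrder.succOrder P
  let _ : PredOrder P := LinearLocallyFiniteOrder.predOrder P
  let e : P ≃o ℕ := orderIsoNatOfLinearSuccPredArch
  refine ⟨fun n => (e.symm n).1, fun a b h => e.symm.strictMono h, ?_⟩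
  ext p
  exact ⟨fun ⟨n, hn⟩ => hn ▸ (e.symm n).2, fun hp => ⟨e ⟨p, hp⟩, by simp⟩⟩

/-- A function is a signal iff its switching points lie in an unbounded set of nonnegative reals
with finite initial segments. -/
theorem isSignal_iff_exists_switching_set {x : ℝ → Bool} :
    IsSignal x ↔ ∃ P : Set ℝ, (∀ p ∈ P, 0 ≤ p) ∧ (∀ M, (P ∩ Set.Iic M).Finite) ∧
      (∀ M, ∃ p ∈ P, M < p) ∧ ∀ a b, a ≤ b → (∀ p ∈ P, a < p → b < p) → x a = x b := by
  constructor
  · rintro ⟨t, h0, hmono, hunb, hinit, hstep⟩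
    refine ⟨Set.range t, ?_, fun M => ?_, fun M => ?_, fun a b hab h => ?_⟩
    · rintro _ ⟨k, rfl⟩
      exact h0.trans (hmono.monotone (Nat.zero_le k))
    · obtain ⟨n, hn⟩ := hunb M
      refine ((Set.finite_Iio n).image t).subset ?_
      rintro _ ⟨⟨k, rfl⟩, hk⟩
      exact ⟨k, hmono.lt_iff_lt.1 (lt_of_le_of_lt hk hn), rfl⟩
    · obtain ⟨n, hn⟩ := hunb M
      exact ⟨t n, ⟨n, rfl⟩, hn⟩
    · classical
      have hex := hunb b
      have hlt := Nat.find_spec hex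
      rcases hn : Nat.find hex with _ | n
      · rw [hn] at hlt
        rw [hinit a (hab.trans_lt hlt), hinit b hlt]
      · rw [hn] at hlt
        have hb : t n ≤ b := not_lt.1 (Nat.find_min hex (by omega))
        have ha : t n ≤ a := by
          by_contra! hc
          exact (h _ ⟨n, rfl⟩ hc).not_ge hb
        rw [hstep n a ha (hab.trans_lt hlt), hstep n b hb hlt]
  · rintro ⟨P, h0, hfin, hunb, hconst⟩
    obtain ⟨t, hmono, rfl⟩ := exists_strictMono_enumeration_s13 hfin hunb
    have hzero (k : ℕ) : t 0 ≤ t k := hmono.monotone (Nat.zero_le k)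
    refine ⟨t, h0 _ ⟨0, rfl⟩, hmono, fun M => ?_, fun s hs => ?_, fun k s hk hs => ?_⟩
    · obtain ⟨_, ⟨n, rfl⟩, hn⟩ := hunb M
      exact ⟨n, hn⟩
    · rcases le_total s (t 0 - 1) with h | h
      · refine hconst _ _ h ?_
        rintro _ ⟨k, rfl⟩ -
        linarith [hzero k]
      · refine (hconst _ _ h ?_).symm
        rintro _ ⟨k, rfl⟩ -
        linarith [hzero k]
    · refine (hconst _ _ hk ?_).symm
      rintro _ ⟨j, rfl⟩ hj
      exact hs.trans_le (hmono.monotone (hmono.lt_iff_lt.1 hj))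

theorem infOn_eq_true_iff {x : ℝ → Bool} {a b : ℝ} :
    infOn x a b = true ↔ ∀ ξ ∈ Set.Icc a b, x ξ = true := by
  simp [infOn]

theorem supOn_eq_not_infOn_not (x : ℝ → Bool) (a b : ℝ) :
    supOn x a b = !infOn (fun t => !x t) a b := by
  rw [Bool.eq_iff_iff, Bool.not_eq_true', ← Bool.not_eq_true, infOn_eq_true_iff]
  simp [supOn, and_assoc]

theorem infOn_of_forall_eq {x : ℝ → Bool} {a b : ℝ} (hab : a ≤ b) {c : Bool}
    (h : ∀ ξ ∈ Set.Icc a b, x ξ = c) : infOn x a b = c := by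
  cases c
  · rw [← Bool.not_eq_true, infOn_eq_true_iff]
    intro h'
    have ha : a ∈ Set.Icc a b := ⟨le_rfl, hab⟩
    simpa [h a ha] using h' a ha
  · exact infOn_eq_true_iff.2 h

theorem infOn_translate (x : ℝ → Bool) (c a b : ℝ) :
    infOn (Translate c x) a b = infOn x (a - c) (b - c) := by
  rw [Bool.eq_iff_iff, infOn_eq_true_iff, infOn_eq_true_iff]
  constructor
  · intro h ξ hξ
    simpa [Translate] using h (ξ + c) ⟨by linarith [hξ.1], by linarith [hξ.2]⟩
  · intro h ξ hξ
    exact h (ξ - c) ⟨by linarith [hξ.1], by linarith [hξ.2]⟩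

theorem IsSignal.infOn_window {u : ℝ → Bool} (hu : IsSignal u) {m d : ℝ} (hm : 0 ≤ m)
    (hmd : m ≤ d) : IsSignal (fun t => infOn u (t - d) (t - d + m)) := by
  obtain ⟨P, h0, hfin, hunb, hconst⟩ := isSignal_iff_exists_switching_set.1 hu
  refine isSignal_iff_exists_switching_set.2
    ⟨(fun p => p + d) '' P ∪ (fun p => p + d - m) '' P, ?_, fun M => ?_, fun M => ?_,
      fun a b hab h => ?_⟩
  · rintro _ (⟨p, hp, rfl⟩ | ⟨p, hp, rfl⟩) <;> dsimp only <;> linarith [h0 p hp]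
  · refine (((hfin (M - d)).image fun p => p + d).union
      ((hfin (M - d + m)).image fun p => p + d - m)).subset ?_
    rintro _ ⟨⟨p, hp, rfl⟩ | ⟨p, hp, rfl⟩, hM⟩ <;> simp only [Set.mem_Iic] at hM
    · exact Or.inl ⟨p, ⟨hp, Set.mem_Iic.2 (by linarith)⟩, rfl⟩
    · exact Or.inr ⟨p, ⟨hp, Set.mem_Iic.2 (by linarith)⟩, rfl⟩
  · obtain ⟨p, hp, hM⟩ := hunb (M - d)
    exact ⟨p + d, Or.inl ⟨p, hp, rfl⟩, by linarith⟩
  · have hleft (ξ : ℝ) (h1 : a - d ≤ ξ) (h2 : ξ ≤ b - d) : u ξ = u (b - d) := by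
      refine hconst _ _ h2 fun p hp hlt => ?_
      linarith [h (p + d) (Or.inl ⟨p, hp, rfl⟩) (by linarith)]
    have hright (ξ : ℝ) (h1 : a - d + m ≤ ξ) (h2 : ξ ≤ b - d + m) : u (a - d + m) = u ξ := by
      refine hconst _ _ h1 fun p hp hlt => ?_
      linarith [h (p + d - m) (Or.inr ⟨p, hp, rfl⟩) (by linarith)]
    rw [Bool.eq_iff_iff, infOn_eq_true_iff, infOn_eq_true_iff]
    constructor
    · intro hx ξ hξ
      rcases le_total ξ (a - d + m) with hle | hle
      · exact hx ξ ⟨by linarith [hξ.1], hle⟩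
      · rw [← hright ξ hle hξ.2]
        exact hx _ ⟨by linarith, le_rfl⟩
    · intro hx ξ hξ
      rcases le_total (b - d) ξ with hle | hle
      · exact hx ξ ⟨hle, by linarith [hξ.2]⟩
      · rw [hleft ξ hξ.1 hle]
        exact hx _ ⟨le_rfl, by linarith⟩

/-- If the infimum over a sliding window falls at `t`, then the input is `0` at the right end
of the window. -/
theorem infOn_window_falling {u : ℝ → Bool} {m d t : ℝ}
    (hleft : LeftLim (fun t => infOn u (t - d) (t - d + m)) t true)
    (ht : infOn u (t - d) (t - d + m) = false) : u (t - (d - m)) = false := by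
  obtain ⟨ε, hε, h⟩ := hleft
  by_contra hu
  rw [Bool.not_eq_false] at hu
  rw [← Bool.not_eq_true, infOn_eq_true_iff] at ht
  refine ht fun ξ hξ => ?_
  rcases hξ.2.eq_or_lt with heq | hlt
  · rwa [heq, show t - d + m = t - (d - m) by ring]
  · obtain ⟨s, hs, hst⟩ := exists_between
      (max_lt (show t - ε < t by linarith) (show ξ + d - m < t by linarith))
    obtain ⟨hs1, hs2⟩ := max_lt_iff.1 hs
    exact infOn_eq_true_iff.1 (h s hs1 hst) ξ ⟨by linarith [hξ.1], by linarith⟩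

/-- A stable, translation-equivariant operator on signals defines a deterministic, time invariant
delay condition. -/
theorem deterministic_timeInvariant_of_operator {F : (ℝ → Bool) → ℝ → Bool}
    (hsig : ∀ u, IsSignal u → IsSignal (F u))
    (hstable : ∀ u a t₁, (∀ t, t₁ ≤ t → u t = a) → ∃ t₂, ∀ t, t₂ ≤ t → F u t = a)
    (htrans : ∀ u c t, F (Translate c u) t = F u (t - c)) :
    IsDC (fun u : Signal => {x : Signal | ∀ t : ℝ, x.1 t = F u.1 t}) ∧
      Deterministic (fun u : Signal => {x : Signal | ∀ t : ℝ, x.1 t = F u.1 t}) ∧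
      TimeInvariant (fun u : Signal => {x : Signal | ∀ t : ℝ, x.1 t = F u.1 t}) := by
  refine ⟨fun u => ⟨⟨⟨F u.1, hsig _ u.2⟩, fun _ => rfl⟩, ?_⟩, fun u => ⟨⟨F u.1, hsig _ u.2⟩, ?_⟩,
    fun u x c hu hx => ?_⟩
  · rintro x hx a ⟨t₁, h⟩
    obtain ⟨t₂, h₂⟩ := hstable u.1 a t₁ h
    exact ⟨t₂, fun t ht => (hx t).trans (h₂ t ht)⟩
  · ext x
    exact ⟨fun hx => Subtype.ext (funext hx), fun hx t => by rw [Set.mem_singleton_iff.1 hx]⟩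
  · have hxF (t : ℝ) : Translate c x.1 t = F (Translate c u.1) t := by
      rw [htrans]
      exact hx (t - c)
    refine ⟨?_, hxF⟩
    rw [funext hxF]
    exact hsig _ hu

theorem infOn_window_stable {m d : ℝ} (hm : 0 ≤ m) {u : ℝ → Bool} {a : Bool} {t₁ : ℝ}
    (h : ∀ t, t₁ ≤ t → u t = a) (t : ℝ) (ht : t₁ + d ≤ t) :
    infOn u (t - d) (t - d + m) = a :=
  infOn_of_forall_eq (by linarith) fun ξ hξ => h ξ (by linarith [hξ.1])

theorem infOn_window_translate (m d : ℝ) (u : ℝ → Bool) (c t : ℝ) :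
    infOn (Translate c u) (t - d) (t - d + m) = infOn u (t - c - d) (t - c - d + m) := by
  rw [infOn_translate]
  congr 1 <;> ring

theorem infOn_supOn_DC_properties (m d : ℝ) (hm : 0 ≤ m) (hmd : m ≤ d) :
    (IsDC (fun u : Signal => {x : Signal | ∀ t : ℝ, x.1 t = infOn u.1 (t - d) (t - d + m)}) ∧
      Deterministic (fun u : Signal => {x : Signal | ∀ t : ℝ, x.1 t = infOn u.1 (t - d) (t - d + m)}) ∧
      TimeInvariant (fun u : Signal => {x : Signal | ∀ t : ℝ, x.1 t = infOn u.1 (t - d) (t - d + m)}) ∧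
      ConstantDC (fun u : Signal => {x : Signal | ∀ t : ℝ, x.1 t = infOn u.1 (t - d) (t - d + m)})) ∧
    (IsDC (fun u : Signal => {x : Signal | ∀ t : ℝ, x.1 t = supOn u.1 (t - d) (t - d + m)}) ∧
      Deterministic (fun u : Signal => {x : Signal | ∀ t : ℝ, x.1 t = supOn u.1 (t - d) (t - d + m)}) ∧
      TimeInvariant (fun u : Signal => {x : Signal | ∀ t : ℝ, x.1 t = supOn u.1 (t - d) (t - d + m)}) ∧
      ConstantDC (fun u : Signal => {x : Signal | ∀ t : ℝ, x.1 t = supOn u.1 (t - d) (t - d + m)})) := by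
  constructor
  · obtain ⟨hdc, hdet, htime⟩ := deterministic_timeInvariant_of_operator
      (F := fun u t => infOn u (t - d) (t - d + m))
      (fun u hu => hu.infOn_window hm hmd)
      (fun u a t₁ h => ⟨t₁ + d, infOn_window_stable hm h⟩)
      (infOn_window_translate m d)
    refine ⟨hdc, hdet, htime, d, hm.trans hmd, d - m, sub_nonneg.2 hmd,
      fun u x hx t b hb => ?_⟩
    have hx' : x.1 = fun t => infOn u.1 (t - d) (t - d + m) := funext hx
    rw [hx'] at hb ⊢
    dsimp only
    rcases hxt : infOn u.1 (t - d) (t - d + m)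
    · cases b
      · simp
      · simp [infOn_window_falling hb hxt]
    · simp [infOn_eq_true_iff.1 hxt (t - d) ⟨le_rfl, by linarith⟩]
  · obtain ⟨hdc, hdet, htime⟩ := deterministic_timeInvariant_of_operator
      (F := fun u t => supOn u (t - d) (t - d + m))
      (fun u hu => by
        simp only [supOn_eq_not_infOn_not]
        exact (hu.not.infOn_window hm hmd).not)
      (fun u a t₁ h => ⟨t₁ + d, fun t ht => by
        rw [supOn_eq_not_infOn_not,
          infOn_window_stable (a := !a) hm (fun s hs => by rw [h s hs]) t ht, Bool.not_not]⟩)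
      (fun u c t => by
        simp only [supOn_eq_not_infOn_not]
        exact congrArg _ (infOn_window_translate m d (fun s => !u s) c t))
    refine ⟨hdc, hdet, htime, d - m, sub_nonneg.2 hmd, d, hm.trans hmd,
      fun u x hx t b hb => ?_⟩
    have hx' : x.1 = fun t => !infOn (fun s => !u.1 s) (t - d) (t - d + m) :=
      funext fun t => (hx t).trans (supOn_eq_not_infOn_not _ _ _)
    rw [hx'] at hb ⊢
    dsimp only
    rcases hxt : infOn (fun s => !u.1 s) (t - d) (t - d + m)
    · cases b
      · obtain ⟨ε, hε, h⟩ := hb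
        have hfall := infOn_window_falling (u := fun s => !u.1 s)
          ⟨ε, hε, fun ξ h1 h2 => by simpa using h ξ h1 h2⟩ hxt
        rw [Bool.not_eq_false'] at hfall
        simp [hfall]
      · simp
    · simp [infOn_eq_true_iff.1 hxt (t - d) ⟨le_rfl, by linarith⟩]
end
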